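/- Assume the families B and (G,B) satisfy positivity and that A_k ⊥⊥ G_k | B_k for every k = 0,…,p. With s_k := b_{a_k}((G,B)) − b_{a_k}(B) and r_k := [I_{ā_{k−1}}(Ā_{k−1}) / λ_{ā_{k−1}}(B̄_{k−1})] · (1_{{A_k = a_k}} / π_{a_k}(B_k) − 1) · s_k, one has Cov(ψ_a((G,B)), r_k) = 0 for every k = 0,…,p. (Orthogonality of the residual terms to the larger-set influence function, proof of Lemma 4.1.) -/

import Mathlib

open MeasureTheory ProbabilityTheory

noncomputable section

/-- The σ-algebra generated by a set of real-valued random variables. -/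
def genSig {Ω : Type*} (S : Set (Ω → ℝ)) : MeasurableSpace Ω :=
  ⨆ f ∈ S, MeasurableSpace.comap f (inferInstance : MeasurableSpace ℝ)

/-- Indicator `1_{A = a}` of the event that the random variable `A` takes the value `a`. -/
def ind {Ω : Type*} (A : Ω → ℝ) (a : ℝ) : Ω → ℝ := fun ω => if A ω = a then 1 else 0

/-- `I_{ā_{k-1}}(Ā_{k-1}) = ∏_{j<k} 1_{A_j = a_j}` (equal to `1` when `k = 0`). -/
def indUpto {Ω : Type*} (A : ℕ → Ω → ℝ) (a : ℕ → ℝ) (k : ℕ) : Ω → ℝ :=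
  fun ω => ∏ j ∈ Finset.range k, ind (A j) (a j) ω

variable {Ω : Type*} [MeasurableSpace Ω]

/-- Propensity `π_{a_k}(Z_k) = E[1_{A_k = a_k} ∣ σ(Z_k)]`. -/
def propen (μ : Measure Ω) (A : ℕ → Ω → ℝ) (a : ℕ → ℝ) (Z : ℕ → Set (Ω → ℝ)) (k : ℕ) : Ω → ℝ :=
  μ[ind (A k) (a k) | genSig (Z k)]

/-- Cumulative weight `λ_{ā_{k-1}}(Z̄_{k-1}) = ∏_{j<k} π_{a_j}(Z_j)` (equal to `1` when `k = 0`). -/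
def cumWeight (μ : Measure Ω) (A : ℕ → Ω → ℝ) (a : ℕ → ℝ) (Z : ℕ → Set (Ω → ℝ)) (k : ℕ) :
    Ω → ℝ :=
  fun ω => ∏ j ∈ Finset.range k, propen μ A a Z j ω

/-- The adjustment family `Z` satisfies positivity: the propensities are uniformly bounded away
from `0` almost surely, for every time `k = 0, …, p`. -/
def Positivity (μ : Measure Ω) (A : ℕ → Ω → ℝ) (a : ℕ → ℝ) (Z : ℕ → Set (Ω → ℝ)) (p : ℕ) :
    Prop :=
  ∃ c : ℝ, 0 < c ∧ ∀ k ≤ p, ∀ᵐ ω ∂μ, c ≤ propen μ A a Z k ω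

/-- Auxiliary downward recursion: `bAux μ A a Y Z p n` is the iterated regression
`b_{a_{p-n}}(Z)`. -/
def bAux (μ : Measure Ω) (A : ℕ → Ω → ℝ) (a : ℕ → ℝ) (Y : Ω → ℝ) (Z : ℕ → Set (Ω → ℝ))
    (p : ℕ) : ℕ → Ω → ℝ
  | 0 => fun ω =>
      (μ[fun ω' => Y ω' * ind (A p) (a p) ω' | genSig (Z p)]) ω / propen μ A a Z p ω
  | n + 1 => fun ω =>
      (μ[fun ω' => bAux μ A a Y Z p n ω' * ind (A (p - (n + 1))) (a (p - (n + 1))) ω' |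
          genSig (Z (p - (n + 1)))]) ω / propen μ A a Z (p - (n + 1)) ω

/-- Iterated regression `b_{a_k}(Z)`, for `k = 0, …, p`. -/
def breg (μ : Measure Ω) (A : ℕ → Ω → ℝ) (a : ℕ → ℝ) (Y : Ω → ℝ) (Z : ℕ → Set (Ω → ℝ))
    (p k : ℕ) : Ω → ℝ :=
  bAux μ A a Y Z p (p - k)

/-- `b_{a_{k-1}}(Z)` with the convention `b_{a_{-1}}(Z) = E[b_{a_0}(Z)]` (a constant). -/
def bregPrev (μ : Measure Ω) (A : ℕ → Ω → ℝ) (a : ℕ → ℝ) (Y : Ω → ℝ) (Z : ℕ → Set (Ω → ℝ))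
    (p k : ℕ) : Ω → ℝ :=
  if k = 0 then fun _ => ∫ ω, breg μ A a Y Z p 0 ω ∂μ else breg μ A a Y Z p (k - 1)

/-- The influence function `ψ_a(Z)`. -/
def psi (μ : Measure Ω) (A : ℕ → Ω → ℝ) (a : ℕ → ℝ) (Y : Ω → ℝ) (Z : ℕ → Set (Ω → ℝ))
    (p : ℕ) : Ω → ℝ := fun ω =>
  indUpto A a (p + 1) ω * (Y ω - breg μ A a Y Z p p ω) / cumWeight μ A a Z (p + 1) ω +
    ∑ k ∈ Finset.range (p + 1),
      indUpto A a k ω * (breg μ A a Y Z p k ω - bregPrev μ A a Y Z p k ω) /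
        cumWeight μ A a Z k ω

end

section EssBdd

variable {Ω : Type*} {m m' mΩ : MeasurableSpace Ω} {μ : Measure Ω}
  {f g : Ω → ℝ}

/-- `f` is `m`-measurable and `μ`-essentially bounded. -/
def EssBdd (μ : Measure Ω) (m : MeasurableSpace Ω) (f : Ω → ℝ) : Prop :=
  StronglyMeasurable[m] f ∧ MemLp f ⊤ μ

namespace EssBdd

lemma mono (hf : EssBdd μ m f) (h : m ≤ m') : EssBdd μ m' f :=
  ⟨hf.1.mono h, hf.2⟩

lemma mul (hf : EssBdd μ m f) (hg : EssBdd μ m g) : EssBdd μ m (fun ω => f ω * g ω) :=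
  ⟨hf.1.mul hg.1, hg.2.mul' hf.2⟩

lemma sub (hf : EssBdd μ m f) (hg : EssBdd μ m g) : EssBdd μ m (fun ω => f ω - g ω) :=
  ⟨hf.1.sub hg.1, hf.2.sub hg.2⟩

lemma const (c : ℝ) : EssBdd μ m (fun _ => c) :=
  ⟨stronglyMeasurable_const, memLp_top_const c⟩

lemma finset_prod {ι : Type*} {s : Finset ι} {F : ι → Ω → ℝ} (h : ∀ i ∈ s, EssBdd μ m (F i)) :
    EssBdd μ m (fun ω => ∏ i ∈ s, F i ω) := by
  classical
  induction s using Finset.induction_on with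
  | empty => simpa using const 1
  | insert i s hi ih =>
    simp only [Finset.prod_insert hi]
    exact (h i (s.mem_insert_self i)).mul (ih fun j hj => h j (Finset.mem_insert_of_mem hj))

lemma of_bound (hm : m ≤ mΩ) (hf : StronglyMeasurable[m] f) (C : ℝ) (h : ∀ᵐ ω ∂μ, |f ω| ≤ C) :
    EssBdd μ m f :=
  ⟨hf, memLp_top_of_bound (hf.mono hm).aestronglyMeasurable C h⟩

lemma inv (hm : m ≤ mΩ) (hf : EssBdd μ m f) {c : ℝ} (hc : 0 < c) (h : ∀ᵐ ω ∂μ, c ≤ f ω) :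
    EssBdd μ m (fun ω => (f ω)⁻¹) := by
  refine of_bound hm hf.1.measurable.inv.stronglyMeasurable c⁻¹ ?_
  filter_upwards [h] with ω hω
  rw [abs_of_pos (inv_pos.2 (hc.trans_le hω))]
  exact inv_anti₀ hc hω

lemma condExp (hf : EssBdd μ m' f) : EssBdd μ m (μ[f | m]) :=
  ⟨stronglyMeasurable_condExp, hf.2.condExp le_top⟩

lemma integrable [IsFiniteMeasure μ] (hf : EssBdd μ m f) : Integrable f μ :=
  hf.2.integrable le_top

/-- A bounded `m`-measurable function is orthogonal to functions with zero conditional expectation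
given `m`. -/
lemma integral_mul_eq_zero [IsFiniteMeasure μ] (hm : m ≤ mΩ) (hf : EssBdd μ m f)
    (hg : EssBdd μ m' g) (h : μ[g | m] =ᵐ[μ] 0) : ∫ ω, f ω * g ω ∂μ = 0 := by
  have hfg : Integrable (f * g) μ := (hg.2.mul' hf.2).integrable le_top
  have h1 := condExp_mul_of_stronglyMeasurable_left hf.1 hfg hg.integrable
  rw [← integral_condExp (f := fun ω => f ω * g ω) hm]
  refine integral_eq_zero_of_ae (h1.trans ?_)
  filter_upwards [h] with ω hω
  simp [hω]

end EssBdd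

end EssBdd

section CondIndep

variable {Ω : Type*} {m m₁ m₂ mΩ : MeasurableSpace Ω} {μ : Measure Ω}

/-- Integrals of two integrable functions that agree on all intersections of an `m₁`- and an
`m₂`-measurable set agree on all `m₁ ⊔ m₂`-measurable sets. -/
lemma setIntegral_eq_of_forall_inter (h₁ : m₁ ≤ mΩ) (h₂ : m₂ ≤ mΩ) {f g : Ω → ℝ}
    (hf : Integrable f μ) (hg : Integrable g μ)
    (h : ∀ s t, MeasurableSet[m₁] s → MeasurableSet[m₂] t →
      ∫ ω in s ∩ t, f ω ∂μ = ∫ ω in s ∩ t, g ω ∂μ)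
    {u : Set Ω} (hu : MeasurableSet[m₁ ⊔ m₂] u) : ∫ ω in u, f ω ∂μ = ∫ ω in u, g ω ∂μ := by
  have hle : m₁ ⊔ m₂ ≤ mΩ := sup_le h₁ h₂
  have hgen : m₁ ⊔ m₂ = MeasurableSpace.generateFrom
      {u | ∃ s t, MeasurableSet[m₁] s ∧ MeasurableSet[m₂] t ∧ s ∩ t = u} := by
    refine le_antisymm (sup_le ?_ ?_) (MeasurableSpace.generateFrom_le ?_)
    · intro s hs
      exact MeasurableSpace.measurableSet_generateFrom ⟨s, Set.univ, hs, .univ, Set.inter_univ s⟩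
    · intro t ht
      exact MeasurableSpace.measurableSet_generateFrom ⟨Set.univ, t, .univ, ht, Set.univ_inter t⟩
    · rintro _ ⟨s, t, hs, ht, rfl⟩
      exact (le_sup_left (a := m₁) (b := m₂) s hs).inter (le_sup_right (a := m₁) (b := m₂) t ht)
  have hpi : IsPiSystem {u | ∃ s t, MeasurableSet[m₁] s ∧ MeasurableSet[m₂] t ∧ s ∩ t = u} := by
    rintro _ ⟨s, t, hs, ht, rfl⟩ _ ⟨s', t', hs', ht', rfl⟩ -
    exact ⟨s ∩ s', t ∩ t', hs.inter hs', ht.inter ht', Set.inter_inter_inter_comm s s' t t'⟩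
  have huniv : ∫ ω, f ω ∂μ = ∫ ω, g ω ∂μ := by
    simpa using h Set.univ Set.univ .univ .univ
  induction u, hu using MeasurableSpace.induction_on_inter hgen hpi with
  | empty => simp
  | basic u hu =>
    obtain ⟨s, t, hs, ht, rfl⟩ := hu
    exact h s t hs ht
  | compl u hu ih =>
    have hf' := integral_add_compl (hle u hu) hf
    have hg' := integral_add_compl (hle u hu) hg
    linarith
  | iUnion F hd hF ih =>
    rw [integral_iUnion (fun i => hle _ (hF i)) hd hf.integrableOn,
      integral_iUnion (fun i => hle _ (hF i)) hd hg.integrableOn]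
    exact tsum_congr ih

/-- If `m₁` and `m₂` are conditionally independent given `m`, conditioning an `m₁`-event on
`m₂ ⊔ m` amounts to conditioning on `m`. -/
lemma condExp_indicator_sup_of_condIndep [StandardBorelSpace Ω] [IsFiniteMeasure μ]
    (hm : m ≤ mΩ) (h₁ : m₁ ≤ mΩ) (h₂ : m₂ ≤ mΩ) (h : CondIndep m m₁ m₂ hm μ)
    {s : Set Ω} (hs : MeasurableSet[m₁] s) :
    μ[s.indicator (fun _ => (1 : ℝ)) | m₂ ⊔ m] =ᵐ[μ] μ[s.indicator (fun _ => (1 : ℝ)) | m] := by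
  have hint : ∀ {t : Set Ω}, MeasurableSet[mΩ] t →
      Integrable (t.indicator (fun _ => (1 : ℝ))) μ :=
    fun ht => (integrable_const 1).indicator ht
  have hsΩ : MeasurableSet[mΩ] s := h₁ s hs
  have hmeas : StronglyMeasurable[m₂ ⊔ m] (μ[s.indicator (fun _ => (1 : ℝ)) | m]) :=
    stronglyMeasurable_condExp.mono le_sup_right
  symm
  refine ae_eq_condExp_of_forall_setIntegral_eq (sup_le h₂ hm) (hint hsΩ)
    (fun _ _ _ => integrable_condExp.integrableOn) (fun u hu _ => ?_)
    hmeas.aestronglyMeasurable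
  refine setIntegral_eq_of_forall_inter h₂ hm integrable_condExp (hint hsΩ) (fun t v ht hv => ?_) hu
  have htΩ : MeasurableSet[mΩ] t := h₂ t ht
  have hvΩ : MeasurableSet[mΩ] v := hm v hv
  have hprod : (fun ω => (μ[s.indicator (fun _ => (1 : ℝ)) | m]) ω * t.indicator (fun _ => 1) ω)
      = t.indicator (μ[s.indicator (fun _ => (1 : ℝ)) | m]) := by
    ext ω
    by_cases hω : ω ∈ t <;> simp [hω]
  have hpi : Integrable (fun ω => (μ[s.indicator (fun _ => (1 : ℝ)) | m]) ω *
      t.indicator (fun _ => 1) ω) μ := by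
    rw [hprod]
    exact integrable_condExp.indicator htΩ
  have hpull := condExp_mul_of_stronglyMeasurable_left
    (stronglyMeasurable_condExp (f := s.indicator (fun _ => (1 : ℝ))) (μ := μ) (m := m)) hpi
    (hint htΩ)
  have hci := (condIndep_iff m m₁ m₂ hm h₁ h₂ μ).1 h s t hs ht
  calc ∫ ω in t ∩ v, (μ[s.indicator (fun _ => (1 : ℝ)) | m]) ω ∂μ
      = ∫ ω in v, (μ[s.indicator (fun _ => (1 : ℝ)) | m]) ω * t.indicator (fun _ => 1) ω ∂μ := by
        rw [hprod, setIntegral_indicator htΩ, Set.inter_comm]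
    _ = ∫ ω in v, (μ[(s ∩ t).indicator (fun _ => (1 : ℝ)) | m]) ω ∂μ := by
        rw [← setIntegral_condExp hm hpi hv]
        exact integral_congr_ae (ae_restrict_of_ae (hpull.trans hci.symm))
    _ = ∫ ω in t ∩ v, s.indicator (fun _ => (1 : ℝ)) ω ∂μ := by
        rw [setIntegral_condExp hm (hint (hsΩ.inter htΩ)) hv, Set.inter_comm t v,
          ← setIntegral_indicator htΩ, Set.indicator_indicator, Set.inter_comm t s]

end CondIndep

lemma genSig_mono {Ω : Type*} {S T : Set (Ω → ℝ)} (h : S ⊆ T) : genSig S ≤ genSig T :=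
  biSup_mono fun _ hf => h hf

lemma genSig_union {Ω : Type*} (S T : Set (Ω → ℝ)) : genSig (S ∪ T) = genSig S ⊔ genSig T :=
  iSup_union

lemma measurable_genSig {Ω : Type*} {S : Set (Ω → ℝ)} {f : Ω → ℝ} (hf : f ∈ S) :
    Measurable[genSig S] f :=
  measurable_iff_comap_le.2 (le_biSup (fun f => MeasurableSpace.comap f inferInstance) hf)

lemma ind_eq_indicator {Ω : Type*} (A : Ω → ℝ) (a : ℝ) :
    ind A a = (A ⁻¹' {a}).indicator (fun _ => (1 : ℝ)) := by
  ext ω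
  by_cases h : A ω = a <;> simp [ind, h]

lemma ind_mul_self {Ω : Type*} (A : Ω → ℝ) (a : ℝ) (ω : Ω) :
    ind A a ω * ind A a ω = ind A a ω := by
  simp [ind]

section Regression

variable {Ω : Type*} {m mΩ : MeasurableSpace Ω} {μ : Measure Ω}
  {A : ℕ → Ω → ℝ} {a : ℕ → ℝ} {Y : Ω → ℝ} {Z : ℕ → Set (Ω → ℝ)} {p k : ℕ}

lemma essBdd_ind (hm : m ≤ mΩ) {A : Ω → ℝ} (hA : Measurable[m] A) (a : ℝ) :
    EssBdd μ m (ind A a) := by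
  refine EssBdd.of_bound hm ?_ 1 (ae_of_all μ fun ω => ?_)
  · rw [ind_eq_indicator]
    exact stronglyMeasurable_const.indicator (hA (measurableSet_singleton a))
  · by_cases h : A ω = a <;> simp [ind, h]

lemma essBdd_indUpto (hm : m ≤ mΩ) (hA : ∀ j < k, Measurable[m] (A j)) :
    EssBdd μ m (indUpto A a k) :=
  EssBdd.finset_prod fun j hj => essBdd_ind hm (hA j (Finset.mem_range.1 hj)) (a j)

lemma essBdd_propen (hA : Measurable (A k)) : EssBdd μ (genSig (Z k)) (propen μ A a Z k) :=
  (essBdd_ind le_rfl hA (a k)).condExp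

lemma Positivity.ae_ne_zero (hpos : Positivity μ A a Z p) (hk : k ≤ p) :
    ∀ᵐ ω ∂μ, propen μ A a Z k ω ≠ 0 := by
  obtain ⟨c, hc, h⟩ := hpos
  filter_upwards [h k hk] with ω hω using (hc.trans_le hω).ne'

lemma Positivity.essBdd_inv_propen (hpos : Positivity μ A a Z p) (hA : Measurable (A k))
    (hk : k ≤ p) (hZ : genSig (Z k) ≤ mΩ) :
    EssBdd μ (genSig (Z k)) (fun ω => (propen μ A a Z k ω)⁻¹) := by
  obtain ⟨c, hc, h⟩ := hpos
  exact (essBdd_propen hA).inv hZ hc (h k hk)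

lemma Positivity.essBdd_inv_cumWeight (hpos : Positivity μ A a Z p) (hA : ∀ j, Measurable (A j))
    (hk : k ≤ p + 1) (hm : m ≤ mΩ) (hZ : ∀ j < k, genSig (Z j) ≤ m) :
    EssBdd μ m (fun ω => (cumWeight μ A a Z k ω)⁻¹) := by
  simp only [cumWeight, ← Finset.prod_inv_distrib]
  refine EssBdd.finset_prod fun j hj => ?_
  have hj := Finset.mem_range.1 hj
  exact (hpos.essBdd_inv_propen (hA j) (by omega) ((hZ j hj).trans hm)).mono (hZ j hj)

lemma Positivity.essBdd_bAux (hpos : Positivity μ A a Z p) (hA : ∀ j, Measurable (A j))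
    (hZ : ∀ j ≤ p, genSig (Z j) ≤ mΩ) (hY : EssBdd μ mΩ Y) (n : ℕ) :
    EssBdd μ (genSig (Z (p - n))) (bAux μ A a Y Z p n) := by
  induction n with
  | zero =>
    simp only [bAux, div_eq_mul_inv]
    exact (hY.mul (essBdd_ind le_rfl (hA p) (a p))).condExp.mul
      (hpos.essBdd_inv_propen (hA p) le_rfl (hZ p le_rfl))
  | succ n ih =>
    simp only [bAux, div_eq_mul_inv]
    exact ((ih.mono (hZ _ (Nat.sub_le p n))).mul (essBdd_ind le_rfl (hA _) (a _))).condExp.mul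
      (hpos.essBdd_inv_propen (hA _) (Nat.sub_le p _) (hZ _ (Nat.sub_le p _)))

lemma Positivity.essBdd_breg (hpos : Positivity μ A a Z p) (hA : ∀ j, Measurable (A j))
    (hZ : ∀ j ≤ p, genSig (Z j) ≤ mΩ) (hY : EssBdd μ mΩ Y) (hk : k ≤ p) :
    EssBdd μ (genSig (Z k)) (breg μ A a Y Z p k) := by
  have h := hpos.essBdd_bAux (a := a) hA hZ hY (p - k)
  rwa [Nat.sub_sub_self hk] at h

lemma Positivity.condExp_outcome (hpos : Positivity μ A a Z p) :
    μ[fun ω => Y ω * ind (A p) (a p) ω | genSig (Z p)] =ᵐ[μ]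
      fun ω => breg μ A a Y Z p p ω * propen μ A a Z p ω := by
  filter_upwards [hpos.ae_ne_zero le_rfl] with ω hω
  simp [breg, bAux, hω]

lemma Positivity.condExp_breg_succ (hpos : Positivity μ A a Z p) (hk : k < p) :
    μ[fun ω => breg μ A a Y Z p (k + 1) ω * ind (A k) (a k) ω | genSig (Z k)] =ᵐ[μ]
      fun ω => breg μ A a Y Z p k ω * propen μ A a Z k ω := by
  obtain ⟨n, rfl⟩ : ∃ n, p = k + (n + 1) := ⟨p - k - 1, by omega⟩
  have h1 : k + (n + 1) - k = n + 1 := by omega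
  have h2 : k + (n + 1) - (k + 1) = n := by omega
  filter_upwards [hpos.ae_ne_zero hk.le] with ω hω
  simp only [breg, h1, h2, bAux, Nat.add_sub_cancel]
  rw [div_mul_cancel₀ _ hω]

/-- A weighted difference of a bounded variable and its regression given `m` on the event
`A = a` integrates to zero. -/
lemma integral_weighted_residual_eq_zero [IsFiniteMeasure μ] (hm : m ≤ mΩ) {A : Ω → ℝ} {a : ℝ}
    (hA : Measurable A) {F X b : Ω → ℝ} (hF : EssBdd μ m F) (hX : EssBdd μ mΩ X)
    (hb : EssBdd μ m b)
    (h : μ[fun ω => X ω * ind A a ω | m] =ᵐ[μ] fun ω => b ω * (μ[ind A a | m]) ω) :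
    ∫ ω, F ω * (X ω * ind A a ω - b ω * ind A a ω) ∂μ = 0 := by
  have hi : EssBdd μ mΩ (ind A a) := essBdd_ind le_rfl hA a
  have hXi := hX.mul hi
  have hbi := (hb.mono hm).mul hi
  refine hF.integral_mul_eq_zero hm (hXi.sub hbi) ?_
  have h1 := condExp_sub hXi.integrable hbi.integrable m
  have h2 := condExp_mul_of_stronglyMeasurable_left hb.1 hbi.integrable hi.integrable
  refine h1.trans ?_
  filter_upwards [h, h2] with ω e1 e2
  have e2' : (μ[fun ω => b ω * ind A a ω | m]) ω = b ω * (μ[ind A a | m]) ω := e2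
  simp [e1, e2']

end Regression

/-- orthogonality of the residual terms to the larger-set influence function,
proof of Lemma 4.1.  Under positivity of `B` and `(G, B)` and `A_k ⊥⊥ G_k ∣ B_k` for all `k`,
`Cov(ψ_a((G, B)), r_k) = 0` for every `k = 0, …, p`. -/
theorem psi_residual_orthogonal {Ω : Type*} [mΩ : MeasurableSpace Ω] [StandardBorelSpace Ω]
    (P : Measure Ω) [IsProbabilityMeasure P] (p : ℕ)
    (A : ℕ → Ω → ℝ) (hA : ∀ k, Measurable (A k))
    (hAfin : ∀ k, (Set.range (A k)).Finite)
    (Y : Ω → ℝ) (hYm : Measurable Y) (hYbd : ∃ C : ℝ, ∀ ω, |Y ω| ≤ C)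
    (a : ℕ → ℝ) (ha : ∀ k ≤ p, a k ∈ Set.range (A k))
    (K G B : ℕ → Set (Ω → ℝ)) (hKfin : ∀ k, (K k).Finite)
    (hGle : ∀ k, genSig (G k) ≤ mΩ) (hBle : ∀ k, genSig (B k) ≤ mΩ)
    (hdisj : ∀ k ≤ p, Disjoint (G k) (B k))
    (hcover : ∀ k ≤ p, G k ∪ B k = A '' Set.Iio k ∪ ⋃ j ∈ Set.Iic k, K j)
    (hBpos : Positivity P A a B p)
    (hGBpos : Positivity P A a (fun k => G k ∪ B k) p)
    (hCI : ∀ k ≤ p,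
      CondIndep (genSig (B k)) (MeasurableSpace.comap (A k) inferInstance) (genSig (G k))
        (hBle k) P) :
    ∀ k ≤ p,
      (∫ ω,
          (psi P A a Y (fun j => G j ∪ B j) p ω *
            (indUpto A a k ω / cumWeight P A a B k ω *
              (ind (A k) (a k) ω / propen P A a B k ω - 1) *
              (breg P A a Y (fun j => G j ∪ B j) p k ω - breg P A a Y B p k ω))) ∂P) -
        (∫ ω, psi P A a Y (fun j => G j ∪ B j) p ω ∂P) *
          (∫ ω,
              (indUpto A a k ω / cumWeight P A a B k ω *
                (ind (A k) (a k) ω / propen P A a B k ω - 1) *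
                (breg P A a Y (fun j => G j ∪ B j) p k ω - breg P A a Y B p k ω)) ∂P) = 0 := by
  intro k hk
  have hHle : ∀ j, genSig (G j ∪ B j) ≤ mΩ := fun j => by
    rw [genSig_union]
    exact sup_le (hGle j) (hBle j)
  have hHmono : ∀ i j, i ≤ j → j ≤ p → genSig (G i ∪ B i) ≤ genSig (G j ∪ B j) := by
    intro i j hij hj
    rw [hcover i (hij.trans hj), hcover j hj]
    exact genSig_mono (Set.union_subset_union (Set.image_mono (Set.Iio_subset_Iio hij))
      (Set.biUnion_subset_biUnion_left (Set.Iic_subset_Iic.2 hij)))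
  have hBH : ∀ j, genSig (B j) ≤ genSig (G j ∪ B j) :=
    fun j => genSig_mono Set.subset_union_right
  have hAH : ∀ i j, i < j → j ≤ p → Measurable[genSig (G j ∪ B j)] (A i) := by
    intro i j hij hj
    refine measurable_genSig ?_
    rw [hcover j hj]
    exact Or.inl ⟨i, hij, rfl⟩
  have hY : EssBdd P mΩ Y := by
    obtain ⟨C, hC⟩ := hYbd
    exact EssBdd.of_bound le_rfl hYm.stronglyMeasurable C (ae_of_all P hC)
  have hprop : P[ind (A k) (a k) | genSig (G k ∪ B k)] =ᵐ[P] propen P A a B k := by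
    have h := condExp_indicator_sup_of_condIndep (hBle k) (hA k).comap_le (hGle k) (hCI k hk)
      ⟨{a k}, measurableSet_singleton _, rfl⟩
    rw [← genSig_union, ← ind_eq_indicator] at h
    exact h
  set Z : ℕ → Set (Ω → ℝ) := fun j => G j ∪ B j with hZ
  have hbZ : ∀ j ≤ p, EssBdd P (genSig (Z j)) (breg P A a Y Z p j) := fun j hj =>
    hGBpos.essBdd_breg hA (fun i _ => hHle i) hY hj
  have hWZ : ∀ i j, i ≤ j → j ≤ p → EssBdd P (genSig (Z j)) (fun ω =>
      indUpto A a i ω * (cumWeight P A a Z i ω)⁻¹) := fun i j hij hj =>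
    (essBdd_indUpto (hHle j) fun l hl => hAH l j (by omega) hj).mul
      (hGBpos.essBdd_inv_cumWeight hA (by omega) (hHle j)
        fun l hl => hHmono l j (by omega) hj)
  -- the `σ(Z k)`-measurable factor of the residual
  have hu : EssBdd P (genSig (Z k)) (fun ω => indUpto A a k ω * (cumWeight P A a B k ω)⁻¹ *
      (breg P A a Y Z p k ω - breg P A a Y B p k ω)) :=
    ((essBdd_indUpto (hHle k) fun l hl => hAH l k hl hk).mul
      (hBpos.essBdd_inv_cumWeight hA (by omega) (hHle k)
        fun l hl => (hBH l).trans (hHmono l k hl.le hk))).mul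
      ((hbZ k hk).sub ((hBpos.essBdd_breg hA (fun i _ => hBle i) hY hk).mono (hBH k)))
  have hπ : EssBdd P (genSig (Z k)) (fun ω => (propen P A a B k ω)⁻¹) :=
    (hBpos.essBdd_inv_propen (hA k) hk (hBle k)).mono (hBH k)
  have hindΩ : EssBdd P mΩ (ind (A k) (a k)) := essBdd_ind le_rfl (hA k) (a k)
  set r : Ω → ℝ := fun ω => indUpto A a k ω / cumWeight P A a B k ω *
    (ind (A k) (a k) ω / propen P A a B k ω - 1) *
    (breg P A a Y Z p k ω - breg P A a Y B p k ω) with hr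
  have hrmeas : ∀ m : MeasurableSpace Ω, genSig (Z k) ≤ m → EssBdd P m (ind (A k) (a k)) →
      EssBdd P m r := by
    intro m hm hi
    convert (hu.mono hm).mul ((hi.mul (hπ.mono hm)).sub (EssBdd.const 1)) using 1
    ext ω
    simp only [hr]
    ring
  have hrΩ : EssBdd P mΩ r := hrmeas mΩ (hHle k) hindΩ
  have hpast : ∀ F : Ω → ℝ, EssBdd P (genSig (Z k)) F → ∫ ω, F ω * r ω ∂P = 0 := by
    intro F hF
    have hpr : EssBdd P (genSig (Z k)) (propen P A a B k) := (essBdd_propen (hA k)).mono (hBH k)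
    have h0 : P[fun ω => ind (A k) (a k) ω - propen P A a B k ω | genSig (Z k)] =ᵐ[P] 0 := by
      refine (condExp_sub hindΩ.integrable hpr.integrable _).trans ?_
      rw [condExp_of_stronglyMeasurable (hHle k) hpr.1 hpr.integrable]
      filter_upwards [hprop] with ω hω
      simp [hZ, hω]
    rw [← ((hF.mul hu).mul hπ).integral_mul_eq_zero (hHle k)
      (hindΩ.sub (hpr.mono (hHle k))) h0]
    refine integral_congr_ae ?_
    filter_upwards [hBpos.ae_ne_zero hk] with ω hω
    simp only [hr]
    field_simp
  have hfuture : ∀ i, k ≤ i → i ≤ p → ∀ X : Ω → ℝ, EssBdd P mΩ X →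
      (P[fun ω => X ω * ind (A i) (a i) ω | genSig (Z i)] =ᵐ[P]
        fun ω => breg P A a Y Z p i ω * propen P A a Z i ω) →
      ∫ ω, indUpto A a (i + 1) ω * (X ω - breg P A a Y Z p i ω) / cumWeight P A a Z (i + 1) ω *
        r ω ∂P = 0 := by
    intro i hki hi X hX hreg
    have hW : EssBdd P (genSig (Z i)) (fun ω =>
        indUpto A a i ω * (cumWeight P A a Z (i + 1) ω)⁻¹) :=
      (essBdd_indUpto (hHle i) fun l hl => hAH l i hl hi).mul
        (hGBpos.essBdd_inv_cumWeight hA (by omega) (hHle i)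
          fun l hl => hHmono l i (by omega) hi)
    obtain ⟨r', hr', hrr'⟩ : ∃ r' : Ω → ℝ, EssBdd P (genSig (Z i)) r' ∧
        ∀ ω, ind (A i) (a i) ω * r ω = ind (A i) (a i) ω * r' ω := by
      rcases hki.eq_or_lt with rfl | hlt
      · refine ⟨_, hu.mul (hπ.sub (EssBdd.const 1)), fun ω => ?_⟩
        simp only [hr]
        linear_combination (indUpto A a k ω * (cumWeight P A a B k ω)⁻¹ *
          (breg P A a Y Z p k ω - breg P A a Y B p k ω) * (propen P A a B k ω)⁻¹) *
          ind_mul_self (A k) (a k) ω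
      · exact ⟨r, hrmeas _ (hHmono k i hki hi) (essBdd_ind (hHle i) (hAH k i hlt hi) (a k)),
          fun _ => rfl⟩
    rw [← integral_weighted_residual_eq_zero (hHle i) (hA i) (hW.mul hr') hX (hbZ i hi) hreg]
    congr 1
    ext ω
    simp only [indUpto, Finset.prod_range_succ]
    linear_combination ((∏ j ∈ Finset.range i, ind (A j) (a j) ω) *
      (cumWeight P A a Z (i + 1) ω)⁻¹ * (X ω - breg P A a Y Z p i ω)) * hrr' ω
  have hr0 : ∫ ω, r ω ∂P = 0 := by
    simpa using hpast _ (EssBdd.const 1)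
  have hprev : ∀ j l, j ≤ l → l ≤ p →
      EssBdd P (genSig (Z l)) (bregPrev P A a Y Z p j) := by
    intro j l hjl hl
    unfold bregPrev
    split_ifs with h
    · exact EssBdd.const _
    · exact (hbZ (j - 1) (by omega)).mono (hHmono _ l (by omega) hl)
  have hterm : ∀ j ≤ p, ∀ l, j ≤ l → l ≤ p → EssBdd P (genSig (Z l)) (fun ω =>
      indUpto A a j ω * (breg P A a Y Z p j ω - bregPrev P A a Y Z p j ω) /
        cumWeight P A a Z j ω) := by
    intro j hj l hjl hl
    convert (hWZ j l hjl hl).mul (((hbZ j hj).mono (hHmono j l hjl hl)).sub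
      (hprev j l hjl hl)) using 1
    ext ω
    ring
  have hlast : EssBdd P mΩ (fun ω => indUpto A a (p + 1) ω * (Y ω - breg P A a Y Z p p ω) /
      cumWeight P A a Z (p + 1) ω) := by
    convert ((essBdd_indUpto le_rfl fun l _ => hA l).mul (hGBpos.essBdd_inv_cumWeight hA le_rfl
      le_rfl fun l _ => hHle l)).mul (hY.sub ((hbZ p le_rfl).mono (hHle p))) using 1
    ext ω
    ring
  rw [hr0, mul_zero, sub_zero]
  simp only [psi, add_mul, Finset.sum_mul]
  have hterm_int : ∀ j ∈ Finset.range (p + 1), Integrable (fun ω =>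
      indUpto A a j ω * (breg P A a Y Z p j ω - bregPrev P A a Y Z p j ω) /
        cumWeight P A a Z j ω * r ω) P := fun j hj => by
    have hj := Nat.lt_succ_iff.1 (Finset.mem_range.1 hj)
    exact (((hterm j hj j le_rfl hj).mono (hHle j)).mul hrΩ).integrable
  rw [integral_add (hlast.mul hrΩ).integrable (integrable_finsetSum _ hterm_int),
    hfuture p hk le_rfl Y hY hGBpos.condExp_outcome, zero_add, integral_finsetSum _ hterm_int]
  refine Finset.sum_eq_zero fun j hj => ?_
  have hj := Nat.lt_succ_iff.1 (Finset.mem_range.1 hj)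
  rcases le_or_gt j k with hjk | hjk
  · exact hpast _ (hterm j hj k hjk hk)
  · obtain ⟨i, rfl⟩ : ∃ i, j = i + 1 := ⟨j - 1, by omega⟩
    have hb : bregPrev P A a Y Z p (i + 1) = breg P A a Y Z p i := by simp [bregPrev]
    rw [hb]
    exact hfuture i (by omega) (by omega) _ ((hbZ (i + 1) hj).mono (hHle (i + 1)))
      (hGBpos.condExp_breg_succ (by omega))
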